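/- Let 0<q<1 be real, h1,h2,l1,l2,α1,α2,β real, t1,t2 nonzero complex, and let (i,i') = (1,2) or (2,1). Suppose β = ε·(−h1+h2+l1−l2+α_i−α_{i'}+2) for some ε ∈ {1,−1}, and set E0 = −(q^{α_i+l1+1/2}t1 + q^{α_i+h2+1/2}t2 + q^{α_{i'}+h1−1/2}t1 + q^{α_{i'}+l2−1/2}t2). Then: (a) the function F1(x) = x^{−α_i}·(q^{h1+1/2}t1/x;q)_∞/(q^{l1+1/2}t1/x;q)_∞ satisfies (A⟨4⟩(x; h1,h2,l1,l2,α1,α2,β)F1)(x) = E0·F1(x) for every nonzero x with x ∉ {q^{l1+n−1/2}t1 : n ∈ ℤ}; (b) the function F2(x) = x^{−α_i+h1−l1}·(x/(q^{l1−1/2}t1);q)_∞/(x/(q^{h1−1/2}t1);q)_∞ satisfies (A⟨4⟩(x; h1,h2,l1,l2,α1,α2,β)F2)(x) = E0·F2(x) for every nonzero x with x ∉ {q^{h1+n−1/2}t1 : n ∈ ℤ}. -/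

import Mathlib

open Filter Topology

/-- The infinite q-Pochhammer symbol `(a;q)_∞ = ∏_{j=0}^∞ (1 - q^j a)`. -/
noncomputable def qPochInf (q : ℝ) (a : ℂ) : ℂ := ∏' j : ℕ, (1 - (q : ℂ) ^ j * a)

/-- `q^r` for a real exponent `r`, using the principal branch of the complex power. -/
noncomputable def qpow (q : ℝ) (r : ℝ) : ℂ := (q : ℂ) ^ (r : ℂ)

/-- The fourth degenerate Ruijsenaars–van Diejen operator `A⟨4⟩` applied to `g` at `x`. -/
noncomputable def A4 (q : ℝ) (t1 t2 : ℂ) (h1 h2 l1 l2 a1 a2 b : ℝ) (g : ℂ → ℂ) (x : ℂ) : ℂ :=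
  x⁻¹ * (x - qpow q (h1 + 1/2) * t1) * (x - qpow q (h2 + 1/2) * t2) * g (x / (q : ℂ))
    + qpow q (a1 + a2) * x⁻¹ * (x - qpow q (l1 - 1/2) * t1) * (x - qpow q (l2 - 1/2) * t2) *
        g ((q : ℂ) * x)
    - ((qpow q a1 + qpow q a2) * x
        + qpow q ((h1 + h2 + l1 + l2 + a1 + a2) / 2) * (qpow q (b / 2) + qpow q (-(b / 2))) *
            t1 * t2 * x⁻¹) * g x

lemma qpow_ne_zero {q : ℝ} (hq : 0 < q) (r : ℝ) : qpow q r ≠ 0 := by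
  have hq' : (q : ℂ) ≠ 0 := by exact_mod_cast hq.ne'
  simp [qpow, Complex.cpow_eq_zero_iff, hq']

lemma qpow_add {q : ℝ} (hq : 0 < q) (r s : ℝ) : qpow q (r + s) = qpow q r * qpow q s := by
  have hq' : (q : ℂ) ≠ 0 := by exact_mod_cast hq.ne'
  simp only [qpow, Complex.ofReal_add, Complex.cpow_add _ _ hq']

lemma qpow_one (q : ℝ) : qpow q 1 = q := by
  simp [qpow]

lemma ofReal_mul_cpow {q : ℝ} (hq : 0 < q) {x : ℂ} (hx : x ≠ 0) (s : ℝ) :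
    ((q : ℂ) * x) ^ (s : ℂ) = qpow q s * x ^ (s : ℂ) := by
  have hq' : (q : ℂ) ≠ 0 := by exact_mod_cast hq.ne'
  rw [qpow, Complex.cpow_def_of_ne_zero (mul_ne_zero hq' hx), Complex.cpow_def_of_ne_zero hq',
    Complex.cpow_def_of_ne_zero hx, Complex.log_ofReal_mul hq hx, Complex.ofReal_log hq.le,
    add_mul, Complex.exp_add]

lemma cpow_eq_qpow_mul_div_cpow {q : ℝ} (hq : 0 < q) {x : ℂ} (hx : x ≠ 0) (s : ℝ) :
    x ^ (s : ℂ) = qpow q s * (x / q) ^ (s : ℂ) := by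
  have hq' : (q : ℂ) ≠ 0 := by exact_mod_cast hq.ne'
  rw [← ofReal_mul_cpow hq (div_ne_zero hx hq'), mul_div_cancel₀ _ hq']

lemma multipliable_one_sub_pow_mul {q : ℝ} (hq0 : 0 < q) (hq1 : q < 1) (a : ℂ) :
    Multipliable fun j : ℕ => 1 - (q : ℂ) ^ j * a := by
  have h : Summable fun j : ℕ => ‖-((q : ℂ) ^ j * a)‖ := by
    simp only [norm_neg, norm_mul, norm_pow, Complex.norm_real, Real.norm_of_nonneg hq0.le]
    exact (summable_geometric_of_lt_one hq0.le hq1).mul_right _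
  simpa only [sub_eq_add_neg] using multipliable_one_add_of_summable h

/-- The functional equation `(a;q)_∞ = (1 - a) (qa;q)_∞`. -/
lemma qPochInf_eq_mul {q : ℝ} (hq0 : 0 < q) (hq1 : q < 1) (a : ℂ) :
    qPochInf q a = (1 - a) * qPochInf q (q * a) := by
  have hs : (fun j : ℕ => 1 - (q : ℂ) ^ (j + 1) * a) = fun j => 1 - (q : ℂ) ^ j * (q * a) := by
    ext j
    ring
  have hm := multipliable_one_sub_pow_mul hq0 hq1 (q * a)
  rw [← hs] at hm
  have h := tprod_eq_zero_mul' (f := fun j : ℕ => 1 - (q : ℂ) ^ j * a) hm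
  rw [hs, pow_zero, one_mul] at h
  exact h

/-- The `x⁻¹`-coefficient of `A⟨4⟩` when `β` takes one of the two special values. -/
lemma qpow_half_sum_mul {q : ℝ} (hq : 0 < q) {h1 h2 l1 l2 a1 a2 b ai ai' : ℝ}
    (hadd : a1 + a2 = ai + ai')
    (hb : b = -h1 + h2 + l1 - l2 + ai - ai' + 2 ∨ b = -(-h1 + h2 + l1 - l2 + ai - ai' + 2)) :
    qpow q ((h1 + h2 + l1 + l2 + a1 + a2) / 2) * (qpow q (b / 2) + qpow q (-(b / 2)))
      = qpow q (ai + l1 + 1/2) * qpow q (h2 + 1/2)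
        + qpow q (ai' + h1 - 1/2) * qpow q (l2 - 1/2) := by
  obtain rfl : a1 = ai + ai' - a2 := by linarith
  rw [mul_add]
  simp only [← qpow_add hq]
  rcases hb with rfl | rfl
  · congr 2 <;> ring
  · rw [add_comm]
    congr 2 <;> ring

/-- A function satisfying two compatible first-order `q`-difference relations is an eigenfunction
of `A⟨4⟩`. -/
lemma A4_eq_of_first_order {q : ℝ} (hq : 0 < q) {h1 h2 l1 l2 a1 a2 b ai ai' : ℝ} {t1 t2 : ℂ}
    (hii : (ai = a1 ∧ ai' = a2) ∨ (ai = a2 ∧ ai' = a1))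
    (hb : b = -h1 + h2 + l1 - l2 + ai - ai' + 2 ∨ b = -(-h1 + h2 + l1 - l2 + ai - ai' + 2))
    {g : ℂ → ℂ} {x : ℂ} (hx : x ≠ 0)
    (hdown : (x - qpow q (h1 + 1/2) * t1) * g (x / q)
      = qpow q ai * (x - qpow q (l1 + 1/2) * t1) * g x)
    (hup : qpow q ai * (x - qpow q (l1 - 1/2) * t1) * g (q * x)
      = (x - qpow q (h1 - 1/2) * t1) * g x) :
    A4 q t1 t2 h1 h2 l1 l2 a1 a2 b g x
      = -(qpow q (ai + l1 + 1/2) * t1 + qpow q (ai + h2 + 1/2) * t2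
        + qpow q (ai' + h1 - 1/2) * t1 + qpow q (ai' + l2 - 1/2) * t2) * g x := by
  have hadd : a1 + a2 = ai + ai' := by
    rcases hii with ⟨rfl, rfl⟩ | ⟨rfl, rfl⟩ <;> ring
  have hsum : qpow q a1 + qpow q a2 = qpow q ai + qpow q ai' := by
    rcases hii with ⟨rfl, rfl⟩ | ⟨rfl, rfl⟩ <;> ring
  rw [A4, hsum, qpow_half_sum_mul hq hadd hb, hadd, qpow_add hq ai ai']
  simp only [add_assoc, add_sub_assoc, qpow_add hq ai, qpow_add hq ai'] at *
  generalize qpow q (h1 + 1/2) = H₁ at *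
  generalize qpow q (h1 - 1/2) = H₁' at *
  generalize qpow q (l1 + 1/2) = L₁' at *
  generalize qpow q (l1 - 1/2) = L₁ at *
  generalize qpow q (h2 + 1/2) = H₂ at *
  generalize qpow q (l2 - 1/2) = L₂ at *
  generalize g (x / q) = u at *
  generalize g (q * x) = v at *
  field_simp
  linear_combination (x - H₂ * t2) * hdown + qpow q ai' * (x - L₂ * t2) * hup

lemma qpow_succ_half {q : ℝ} (hq : 0 < q) (r : ℝ) :
    qpow q (r + 1/2) = q * qpow q (r - 1/2) := by
  rw [← qpow_one q, ← qpow_add hq]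
  congr 1
  ring

theorem stmt18 (q : ℝ) (hq0 : 0 < q) (hq1 : q < 1)
    (h1 h2 l1 l2 a1 a2 b : ℝ) (t1 t2 : ℂ) (ht1 : t1 ≠ 0) (ht2 : t2 ≠ 0)
    (ai ai' : ℝ) (hii : (ai = a1 ∧ ai' = a2) ∨ (ai = a2 ∧ ai' = a1))
    (hb : b = -h1 + h2 + l1 - l2 + ai - ai' + 2 ∨ b = -(-h1 + h2 + l1 - l2 + ai - ai' + 2))
    (E0 : ℂ)
    (hE0 : E0 = -(qpow q (ai + l1 + 1/2) * t1 + qpow q (ai + h2 + 1/2) * t2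
      + qpow q (ai' + h1 - 1/2) * t1 + qpow q (ai' + l2 - 1/2) * t2)) :
    (∀ x : ℂ, x ≠ 0 → (∀ n : ℤ, x ≠ qpow q (l1 + n - 1/2) * t1) →
      A4 q t1 t2 h1 h2 l1 l2 a1 a2 b
        (fun y => y ^ ((-ai : ℝ) : ℂ) *
          (qPochInf q (qpow q (h1 + 1/2) * t1 / y) / qPochInf q (qpow q (l1 + 1/2) * t1 / y))) x
        = E0 * (x ^ ((-ai : ℝ) : ℂ) *
            (qPochInf q (qpow q (h1 + 1/2) * t1 / x) /
              qPochInf q (qpow q (l1 + 1/2) * t1 / x)))) ∧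
    (∀ x : ℂ, x ≠ 0 → (∀ n : ℤ, x ≠ qpow q (h1 + n - 1/2) * t1) →
      A4 q t1 t2 h1 h2 l1 l2 a1 a2 b
        (fun y => y ^ ((-ai + h1 - l1 : ℝ) : ℂ) *
          (qPochInf q (y / (qpow q (l1 - 1/2) * t1)) /
            qPochInf q (y / (qpow q (h1 - 1/2) * t1)))) x
        = E0 * (x ^ ((-ai + h1 - l1 : ℝ) : ℂ) *
            (qPochInf q (x / (qpow q (l1 - 1/2) * t1)) /
              qPochInf q (x / (qpow q (h1 - 1/2) * t1))))) := by
  subst hE0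
  have hq' : (q : ℂ) ≠ 0 := by exact_mod_cast hq0.ne'
  have hP := qPochInf_eq_mul hq0 hq1
  have hH := qpow_ne_zero hq0 (h1 - 1/2)
  have hL := qpow_ne_zero hq0 (l1 - 1/2)
  have hneg : qpow q ai * qpow q (-ai) = 1 := by
    rw [← qpow_add hq0]
    simp [qpow]
  have hshift : qpow q ai * qpow q (-ai + h1 - l1) * qpow q (l1 - 1/2) = qpow q (h1 - 1/2) := by
    rw [← qpow_add hq0, ← qpow_add hq0]
    congr 1
    ring
  refine ⟨fun x hx hxn => A4_eq_of_first_order hq0 hii hb hx ?_ ?_,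
    fun x hx hxn => A4_eq_of_first_order hq0 hii hb hx ?_ ?_⟩
  · have hx1 : x - q * qpow q (l1 - 1/2) * t1 ≠ 0 := by
      have := hxn 1
      rw [Int.cast_one, add_sub_assoc] at this
      rw [← qpow_succ_half hq0, sub_ne_zero]
      convert this using 3
      norm_num
    have e := cpow_eq_qpow_mul_div_cpow hq0 hx (-ai)
    simp only [qpow_succ_half hq0]
    generalize qpow q (h1 - 1/2) = H at *
    generalize qpow q (l1 - 1/2) = L at *
    rw [show q * H * t1 / (x / q) = q * (q * H * t1 / x) by field_simp,
      show q * L * t1 / (x / q) = q * (q * L * t1 / x) by field_simp, hP (q * H * t1 / x),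
      hP (q * L * t1 / x), e, mul_div_mul_comm, one_sub_div hx, one_sub_div hx]
    generalize (x / q) ^ ((-ai : ℝ) : ℂ) = X
    generalize qPochInf q _ / qPochInf q _ = R
    generalize x - q * L * t1 = d at *
    field_simp
    linear_combination (-(x - q * H * t1) * X * R) * hneg
  · have hx1 : x - qpow q (l1 - 1/2) * t1 ≠ 0 := by
      have := hxn 0
      rwa [Int.cast_zero, add_zero, ← sub_ne_zero] at this
    have e := ofReal_mul_cpow hq0 hx (-ai)
    simp only [qpow_succ_half hq0]
    generalize qpow q (h1 - 1/2) = H at *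
    generalize qpow q (l1 - 1/2) = L at *
    rw [show q * H * t1 / (q * x) = H * t1 / x by field_simp,
      show q * L * t1 / (q * x) = L * t1 / x by field_simp, e, hP (H * t1 / x), hP (L * t1 / x),
      show q * H * t1 / x = q * (H * t1 / x) by ring,
      show q * L * t1 / x = q * (L * t1 / x) by ring,
      mul_div_mul_comm, one_sub_div hx, one_sub_div hx]
    generalize x ^ ((-ai : ℝ) : ℂ) = X
    generalize qPochInf q _ / qPochInf q _ = R
    field_simp
    linear_combination ((x - H * t1) * X * R) * hneg
  · have hx1 : q * qpow q (h1 - 1/2) * t1 - x ≠ 0 := by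
      have := hxn 1
      rw [Int.cast_one, add_sub_assoc] at this
      rw [← qpow_succ_half hq0, sub_ne_zero]
      convert this.symm using 3
      norm_num
    have e := cpow_eq_qpow_mul_div_cpow hq0 hx (-ai + h1 - l1)
    simp only [qpow_succ_half hq0]
    generalize qpow q (h1 - 1/2) = H at *
    generalize qpow q (l1 - 1/2) = L at *
    have hHt : q * H * t1 ≠ 0 := by positivity
    have hLt : q * L * t1 ≠ 0 := by positivity
    rw [show x / q / (H * t1) = x / (q * H * t1) by field_simp,
      show x / q / (L * t1) = x / (q * L * t1) by field_simp, e,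
      hP (x / (q * H * t1)), hP (x / (q * L * t1)),
      show q * (x / (q * H * t1)) = x / (H * t1) by field_simp,
      show q * (x / (q * L * t1)) = x / (L * t1) by field_simp,
      mul_div_mul_comm, one_sub_div hHt, one_sub_div hLt, ← neg_sub (q * H * t1) x]
    generalize (x / q) ^ ((-ai + h1 - l1 : ℝ) : ℂ) = X
    generalize qPochInf q _ / qPochInf q _ = R
    generalize q * H * t1 - x = d at *
    field_simp
    linear_combination (-(x - q * L * t1) * X * R) * hshift
  · have hx1 : qpow q (h1 - 1/2) * t1 - x ≠ 0 := by
      have := (hxn 0).symm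
      rwa [Int.cast_zero, add_zero, ← sub_ne_zero] at this
    have e := ofReal_mul_cpow hq0 hx (-ai + h1 - l1)
    generalize qpow q (h1 - 1/2) = H at *
    generalize qpow q (l1 - 1/2) = L at *
    have hHt : H * t1 ≠ 0 := by positivity
    have hLt : L * t1 ≠ 0 := by positivity
    rw [e, hP (x / (H * t1)), hP (x / (L * t1)), mul_div_assoc (q : ℂ) x,
      mul_div_assoc (q : ℂ) x, mul_div_mul_comm, one_sub_div hHt, one_sub_div hLt, ← neg_sub (H * t1) x]
    generalize x ^ ((-ai + h1 - l1 : ℝ) : ℂ) = X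
    generalize qPochInf q _ / qPochInf q _ = R
    generalize H * t1 - x = d at *
    field_simp
    linear_combination ((x - L * t1) * X * R) * hshift
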